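/- Let n ≥ 1 be an integer, μ > 0 a real number, and F(θ) = √(∑_{k=0}^{n−1} (cos θ)^{2k}). Consider the vector field X on ℝ³ given by X(θ,T,Q) = ( −6μ·F(θ)·((T−1)·cos θ + T)/n + 3Q(T−1)·F(θ)²·sin(2θ)/(2n), −3Q(T−1)²·T·((cos θ)^{2n} − 1)/n, (Q²−1)(T−1)(3(cos θ)^{2n} − 1) ). Then the point (θ,T,Q) = (0, 1/2, 1) is an equilibrium of X and it is unstable (it is not Lyapunov stable). -/

import Mathlib

open Real Filter

noncomputable section

/-- Lyapunov stability of the equilibrium `p` of the vector field `X` on the domain `D`. -/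
def LyapunovStable {E : Type*} [NormedAddCommGroup E] [NormedSpace ℝ E]
    (X : E → E) (D : Set E) (p : E) : Prop :=
  ∀ ε > 0, ∃ δ > 0, ∀ γ : ℝ → E,
    (∀ t : ℝ, 0 ≤ t → γ t ∈ D) →
    (∀ t : ℝ, 0 ≤ t → HasDerivAt γ (X (γ t)) t) →
    ‖γ 0 - p‖ < δ → ∀ t : ℝ, 0 ≤ t → ‖γ t - p‖ < ε

/-- `F θ = √(∑_{k=0}^{n-1} (cos θ)^{2k})`. -/
def F (n : ℕ) (θ : ℝ) : ℝ :=
  Real.sqrt (∑ k ∈ Finset.range n, Real.cos θ ^ (2 * k))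

/-- The unwrapped vector field (non-flat, Λ = 0, detailed balance, E-model potential);
coordinates `(θ, T, Q)`. -/
def X7 (n : ℕ) (μ : ℝ) (p : ℝ × ℝ × ℝ) : ℝ × ℝ × ℝ :=
  (-6 * μ * F n p.1 * ((p.2.1 - 1) * Real.cos p.1 + p.2.1) / n
      + 3 * p.2.2 * (p.2.1 - 1) * F n p.1 ^ 2 * Real.sin (2 * p.1) / (2 * n),
   -3 * p.2.2 * (p.2.1 - 1) ^ 2 * p.2.1 * (Real.cos p.1 ^ (2 * n) - 1) / n,
   (p.2.2 ^ 2 - 1) * (p.2.1 - 1) * (3 * Real.cos p.1 ^ (2 * n) - 1))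

open scoped Manifold NNReal in
/-- A bounded `C¹` vector field on a proper real normed space has global integral curves. -/
theorem exists_hasDerivAt_of_contDiff_of_bounded {E : Type*} [NormedAddCommGroup E]
    [NormedSpace ℝ E] [ProperSpace E] {v : E → E} (hv : ContDiff ℝ 1 v) {L : ℝ}
    (hL : ∀ x, ‖v x‖ ≤ L) (x : E) :
    ∃ γ : ℝ → E, γ 0 = x ∧ ∀ t, HasDerivAt γ (v (γ t)) t := by
  have hL₀ : 0 ≤ L := (norm_nonneg _).trans (hL x)
  have hloc : ∀ a : ℝ, ∃ γ : ℝ → E, γ 0 = x ∧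
      IsMIntegralCurveOn (I := 𝓘(ℝ, E)) γ v (Set.Ioo (-a) a) := by
    intro a
    have h0 : (0 : ℝ) ∈ Set.Icc (-|a|) |a| := by simp
    obtain ⟨K, hK⟩ := hv.contDiffOn.exists_lipschitzOnWith one_ne_zero
      (convex_closedBall x (L * |a|)) (isCompact_closedBall x (L * |a|))
    have hPL : IsPicardLindelof (fun _ ↦ v) ⟨0, h0⟩ x
        ⟨L * |a|, by positivity⟩ 0 ⟨L, hL₀⟩ K :=
      { lipschitzOnWith := fun _ _ ↦ hK
        continuousOn := fun _ _ ↦ continuousOn_const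
        norm_le := fun _ _ y _ ↦ hL y
        mul_max_le := by
          simp only [sub_zero, zero_sub, neg_neg, max_self, NNReal.coe_zero]
          exact le_rfl }
    obtain ⟨γ, hγ₀, hγ⟩ := hPL.exists_eq_forall_mem_Icc_hasDerivWithinAt₀
    refine ⟨γ, hγ₀, fun t ht ↦ ?_⟩
    have hsub : Set.Ioo (-a) a ⊆ Set.Icc (-|a|) |a| :=
      fun s hs ↦ ⟨by linarith [hs.1, le_abs_self a], by linarith [hs.2, le_abs_self a]⟩
    exact ((hγ t (hsub ht)).mono hsub).hasFDerivWithinAt.hasMFDerivWithinAt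
  obtain ⟨γ, hγ₀, hγ⟩ := (exists_isMIntegralCurve_iff_exists_isMIntegralCurveOn_Ioo
    (I := 𝓘(ℝ, E)) (v := v) (contMDiff_vectorSpace_iff_contDiff.2 hv) x).2 hloc
  refine ⟨γ, hγ₀, fun t ↦ ?_⟩
  have h : HasFDerivAt γ ((1 : ℝ →L[ℝ] ℝ).smulRight (v (γ t))) t :=
    hasMFDerivAt_iff_hasFDerivAt.1 (hγ t)
  simpa using h.hasDerivAt

theorem hasDerivAt_prod_fst {E G : Type*} [NormedAddCommGroup E] [NormedSpace ℝ E]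
    [NormedAddCommGroup G] [NormedSpace ℝ G] {γ : ℝ → E × G} {γ' : E × G} {t : ℝ}
    (h : HasDerivAt γ γ' t) : HasDerivAt (fun t ↦ (γ t).1) γ'.1 t :=
  (hasFDerivAt_fst (𝕜 := ℝ) (p := γ t)).comp_hasDerivAt t h

theorem hasDerivAt_prod_snd {E G : Type*} [NormedAddCommGroup E] [NormedSpace ℝ E]
    [NormedAddCommGroup G] [NormedSpace ℝ G] {γ : ℝ → E × G} {γ' : E × G} {t : ℝ}
    (h : HasDerivAt γ γ' t) : HasDerivAt (fun t ↦ (γ t).2) γ'.2 t :=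
  (hasFDerivAt_snd (𝕜 := ℝ) (p := γ t)).comp_hasDerivAt t h

theorem F_sq (n : ℕ) (θ : ℝ) : F n θ ^ 2 = ∑ k ∈ Finset.range n, cos θ ^ (2 * k) :=
  Real.sq_sqrt (Finset.sum_nonneg fun k _ ↦ (even_two_mul k).pow_nonneg _)

theorem one_le_sum_cos_pow {n : ℕ} (hn : 1 ≤ n) (θ : ℝ) :
    1 ≤ ∑ k ∈ Finset.range n, cos θ ^ (2 * k) := by
  simpa using Finset.single_le_sum (f := fun k ↦ cos θ ^ (2 * k))
    (fun k _ ↦ (even_two_mul k).pow_nonneg _) (Finset.mem_range.2 hn)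

theorem one_le_F {n : ℕ} (hn : 1 ≤ n) (θ : ℝ) : 1 ≤ F n θ :=
  Real.one_le_sqrt.2 (one_le_sum_cos_pow hn θ)

theorem cos_pow_two_mul_le_one (k : ℕ) (θ : ℝ) : cos θ ^ (2 * k) ≤ 1 := by
  rw [pow_mul]
  exact pow_le_one₀ (sq_nonneg _) (Real.cos_sq_le_one θ)

theorem F_sq_le (n : ℕ) (θ : ℝ) : F n θ ^ 2 ≤ n := by
  rw [F_sq]
  simpa using Finset.sum_le_sum fun k (_ : k ∈ Finset.range n) ↦ cos_pow_two_mul_le_one k θ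

theorem contDiff_F {n : ℕ} (hn : 1 ≤ n) : ContDiff ℝ 1 (F n) := by
  refine ContDiff.sqrt (by fun_prop) fun θ ↦ ?_
  exact (zero_lt_one.trans_le (one_le_sum_cos_pow hn θ)).ne'

/-- The restriction of `X7` to the invariant plane `Q = 1`, in the coordinates `(θ, u)` with
`T = sigmoid u`. -/
def planarField (n : ℕ) (μ : ℝ) (p : ℝ × ℝ) : ℝ × ℝ :=
  (-6 * μ * F n p.1 * ((sigmoid p.2 - 1) * cos p.1 + sigmoid p.2) / n
      + 3 * (sigmoid p.2 - 1) * F n p.1 ^ 2 * sin (2 * p.1) / (2 * n),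
   3 * (1 - sigmoid p.2) * (1 - cos p.1 ^ (2 * n)) / n)

theorem contDiff_planarField {n : ℕ} (hn : 1 ≤ n) (μ : ℝ) :
    ContDiff ℝ 1 (planarField n μ) := by
  have hF : ContDiff ℝ 1 fun p : ℝ × ℝ ↦ F n p.1 := (contDiff_F hn).comp contDiff_fst
  have hσ : ContDiff ℝ 1 fun p : ℝ × ℝ ↦ sigmoid p.2 :=
    (contDiff_sigmoid.of_le le_top).comp contDiff_snd
  unfold planarField
  fun_prop

theorem exists_norm_planarField_le {n : ℕ} (hn : 1 ≤ n) (μ : ℝ) :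
    ∃ L, ∀ p, ‖planarField n μ p‖ ≤ L := by
  refine ⟨6 * |μ| + 3, fun p ↦ ?_⟩
  have hn' : (1 : ℝ) ≤ n := by exact_mod_cast hn
  have hs₀ := sigmoid_pos p.2
  have hs₁ := sigmoid_lt_one p.2
  have hF₁ := one_le_F hn p.1
  have hF₂ := F_sq_le n p.1
  have hFn : |F n p.1 / n| ≤ 1 := by
    rw [abs_of_nonneg (by positivity)]
    exact div_le_one_of_le₀ (by nlinarith) (by positivity)
  have hFn₂ : |F n p.1 ^ 2 / n| ≤ 1 := by
    rw [abs_of_nonneg (by positivity)]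
    exact div_le_one_of_le₀ hF₂ (by positivity)
  have hc : |(sigmoid p.2 - 1) * cos p.1 + sigmoid p.2| ≤ 1 := by
    rw [abs_le]
    constructor <;> nlinarith [neg_one_le_cos p.1, cos_le_one p.1]
  have hσ : |sigmoid p.2 - 1| ≤ 1 := by rw [abs_le]; constructor <;> linarith
  rw [Prod.norm_def]
  refine max_le ?_ ?_
  · have key : (planarField n μ p).1 =
        6 * -μ * (F n p.1 / n) * ((sigmoid p.2 - 1) * cos p.1 + sigmoid p.2)
          + 3 / 2 * (sigmoid p.2 - 1) * (F n p.1 ^ 2 / n) * sin (2 * p.1) := by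
      simp only [planarField]
      field_simp
    rw [key, Real.norm_eq_abs]
    calc _ ≤ |6 * -μ * (F n p.1 / n) * ((sigmoid p.2 - 1) * cos p.1 + sigmoid p.2)|
          + |3 / 2 * (sigmoid p.2 - 1) * (F n p.1 ^ 2 / n) * sin (2 * p.1)| := abs_add_le _ _
      _ ≤ 6 * |μ| * 1 * 1 + 3 / 2 * 1 * 1 * 1 := by
        simp only [abs_mul, abs_neg]
        have h6 : |(6 : ℝ)| = 6 := by norm_num
        have h32 : |(3 / 2 : ℝ)| = 3 / 2 := by norm_num
        rw [h6, h32]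
        gcongr
        exact abs_sin_le_one _
      _ ≤ _ := by linarith
  · have hp₀ : 0 ≤ cos p.1 ^ (2 * n) := (even_two_mul n).pow_nonneg _
    have hp₁ := cos_pow_two_mul_le_one n p.1
    simp only [planarField, Real.norm_eq_abs]
    rw [abs_of_nonneg (div_nonneg (mul_nonneg (by linarith) (by linarith)) (by positivity))]
    refine (div_le_self (mul_nonneg (by linarith) (by linarith)) hn').trans ?_
    nlinarith [abs_nonneg μ]

theorem exists_X7_curve {n : ℕ} (hn : 1 ≤ n) (μ θ₀ : ℝ) {T₀ : ℝ} (hT₀ : T₀ ∈ Set.Ioo 0 1) :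
    ∃ θ T : ℝ → ℝ, θ 0 = θ₀ ∧ T 0 = T₀ ∧ (∀ t, T t ∈ Set.Ioo 0 1) ∧
      ∀ t, HasDerivAt (fun t ↦ (θ t, T t, (1 : ℝ))) (X7 n μ (θ t, T t, 1)) t := by
  obtain ⟨L, hL⟩ := exists_norm_planarField_le hn μ
  obtain ⟨u₀, rfl⟩ := range_sigmoid.symm ▸ hT₀
  obtain ⟨γ, hγ₀, hγ⟩ :=
    exists_hasDerivAt_of_contDiff_of_bounded (contDiff_planarField hn μ) hL (θ₀, u₀)
  refine ⟨fun t ↦ (γ t).1, fun t ↦ sigmoid (γ t).2, by simp [hγ₀], by simp [hγ₀],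
    fun t ↦ ⟨sigmoid_pos _, sigmoid_lt_one _⟩, fun t ↦ ?_⟩
  have h₁ := hasDerivAt_prod_fst (hγ t)
  have h₂ := (hasDerivAt_sigmoid _).comp t (hasDerivAt_prod_snd (hγ t))
  refine (h₁.prodMk (h₂.prodMk (hasDerivAt_const t (1 : ℝ)))).congr_deriv ?_
  simp only [X7, planarField, Prod.mk.injEq]
  refine ⟨by ring, by ring, by ring⟩

theorem X7_fst_neg {n : ℕ} (hn : 1 ≤ n) {μ s η θ T : ℝ} (hμ : 0 < μ) (hs : 0 < s)
    (hη : η = 4 * μ * s / n) (hθ : θ = -η) (hTs : 1 / 2 + s ≤ T) (hT₁ : T < 1) :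
    (X7 n μ (θ, T, 1)).1 < 0 := by
  have hn₀ : (0 : ℝ) < n := by exact_mod_cast hn
  have hη₀ : 0 < η := hη ▸ by positivity
  have hηn : η * n = 4 * μ * s := by rw [hη]; field_simp
  have hF₁ := one_le_F hn θ
  have hF₂ := F_sq_le n θ
  have hA : 2 * s ≤ (T - 1) * cos θ + T := by nlinarith [cos_le_one θ]
  have hFA : 2 * s ≤ F n θ * ((T - 1) * cos θ + T) := by nlinarith
  have hsin : -sin (2 * θ) ≤ 2 * η := by
    rw [← sin_neg, hθ]
    exact (sin_le (by linarith)).trans_eq (by ring)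
  have hB : (1 - T) * F n θ ^ 2 * -sin (2 * θ) ≤ 1 / 2 * n * (2 * η) := by
    have h₁ : (1 - T) * F n θ ^ 2 ≤ 1 / 2 * n := by gcongr; linarith
    have h₀ : 0 ≤ (1 - T) * F n θ ^ 2 := mul_nonneg (by linarith) (sq_nonneg _)
    calc _ ≤ (1 - T) * F n θ ^ 2 * (2 * η) := by gcongr
      _ ≤ _ := by gcongr
  have key : (X7 n μ (θ, T, 1)).1 = (-6 * μ * (F n θ * ((T - 1) * cos θ + T))
      + 3 / 2 * ((1 - T) * F n θ ^ 2 * -sin (2 * θ))) / n := by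
    simp only [X7]
    field_simp
    ring
  rw [key]
  refine div_neg_of_neg_of_pos ?_ hn₀
  nlinarith [mul_le_mul_of_nonneg_left hFA hμ.le, mul_pos hμ hs]

theorem stmt_7 (n : ℕ) (hn : 1 ≤ n) (μ : ℝ) (hμ : 0 < μ) :
    X7 n μ (0, 1 / 2, 1) = (0, 0, 0) ∧
      ¬ LyapunovStable (X7 n μ) (Set.univ : Set (ℝ × ℝ × ℝ)) (0, 1 / 2, 1) := by
  refine ⟨by simp [X7]; norm_num, fun hstab ↦ ?_⟩
  obtain ⟨δ, hδ, hstab⟩ := hstab (1 / 4) (by norm_num)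
  have hn' : (1 : ℝ) ≤ n := by exact_mod_cast hn
  have hn₀ : (0 : ℝ) < n := by linarith
  obtain ⟨s, hs, hsδ, hs₁⟩ : ∃ s > 0, s * (4 * (1 + μ)) ≤ δ ∧ s * (4 * (1 + μ)) ≤ 1 := by
    refine ⟨min δ 1 / (4 * (1 + μ)), by positivity, ?_, ?_⟩ <;>
      rw [div_mul_cancel₀ _ (by positivity)]
    exacts [min_le_left _ _, min_le_right _ _]
  have hμs : 0 < μ * s := mul_pos hμ hs
  obtain ⟨η, hη⟩ : ∃ η, η = 4 * μ * s / n := ⟨_, rfl⟩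
  have hη₀ : 0 < η := hη ▸ by positivity
  have hηs : η ≤ 4 * μ * s := hη ▸ div_le_self (by positivity) hn'
  obtain ⟨θ, T, hθ₀, hT₀, hT, hX⟩ :=
    exists_X7_curve hn μ (-η) (T₀ := 1 / 2 + s) ⟨by linarith, by nlinarith⟩
  have hθ' : ∀ t, HasDerivAt θ (X7 n μ (θ t, T t, 1)).1 t := fun t ↦
    hasDerivAt_prod_fst (hX t)
  have hT' : ∀ t, HasDerivAt T (X7 n μ (θ t, T t, 1)).2.1 t := fun t ↦
    hasDerivAt_prod_fst (hasDerivAt_prod_snd (hX t))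
  have hclose : ∀ t, 0 ≤ t → |θ t| < 1 / 4 ∧ |T t - 1 / 2| < 1 / 4 := by
    intro t ht
    have h := hstab (fun t ↦ (θ t, T t, 1)) (fun _ _ ↦ trivial) (fun t _ ↦ hX t) ?_ t ht
    · simp only [Prod.norm_def, Prod.mk_sub_mk, sup_lt_iff, sub_zero, Real.norm_eq_abs] at h
      exact ⟨h.1, h.2.1⟩
    · simp only [Prod.norm_def, Prod.mk_sub_mk, sup_lt_iff, sub_zero, Real.norm_eq_abs,
        hθ₀, hT₀, abs_neg, sub_self, abs_zero, abs_of_pos hη₀, add_sub_cancel_left, abs_of_pos hs]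
      exact ⟨by nlinarith, by nlinarith, hδ⟩
  have hTmono : Monotone T := by
    refine monotone_of_hasDerivAt_nonneg hT' fun t ↦ ?_
    have h := cos_pow_two_mul_le_one n (θ t)
    have hTt := (hT t).1
    simp only [X7, Pi.zero_apply]
    refine div_nonneg ?_ hn₀.le
    have := mul_nonneg (mul_nonneg (sq_nonneg (T t - 1)) hTt.le) (sub_nonneg.2 h)
    linarith
  have hTs : ∀ t, 0 ≤ t → 1 / 2 + s ≤ T t := fun t ht ↦ hT₀ ▸ hTmono ht
  have hθη : ∀ t, 0 ≤ t → θ t ≤ -η := by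
    intro t ht
    refine image_le_of_deriv_right_lt_deriv_boundary (a := 0) (b := t) (B := fun _ ↦ -η)
      (fun x _ ↦ (hθ' x).continuousAt.continuousWithinAt)
      (fun x _ ↦ (hθ' x).hasDerivWithinAt) hθ₀.le (fun x ↦ hasDerivAt_const x _) ?_ ⟨ht, le_rfl⟩
    rintro x ⟨hx, -⟩ hxη
    exact X7_fst_neg hn hμ hs hη hxη (hTs x hx) (hT x).2
  obtain ⟨c, hc, hcT⟩ : ∃ c > 0, ∀ t, 0 ≤ t → c ≤ (X7 n μ (θ t, T t, 1)).2.1 := by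
    have hcos : cos η ^ (2 * n) < 1 := by
      have hη₁ : η < 1 := by nlinarith
      have h₁ : cos η < 1 := by
        simpa using cos_lt_cos_of_nonneg_of_le_pi le_rfl (by linarith [pi_gt_three]) hη₀
      exact pow_lt_one₀ (cos_nonneg_of_mem_Icc ⟨by linarith [pi_gt_three],
        by linarith [pi_gt_three]⟩) h₁ (by lia)
    refine ⟨3 * (1 / 16) * (1 / 2) * (1 - cos η ^ (2 * n)) / n,
      div_pos (mul_pos (by norm_num) (by linarith)) hn₀, fun t ht ↦ ?_⟩
    obtain ⟨hθt, hTt⟩ := hclose t ht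
    rw [abs_lt] at hθt hTt
    have hle : cos (θ t) ^ (2 * n) ≤ cos η ^ (2 * n) := by
      rw [← cos_neg (θ t)]
      have := hθη t ht
      refine pow_le_pow_left₀ (cos_nonneg_of_mem_Icc ⟨by linarith [pi_gt_three],
        by linarith [pi_gt_three]⟩) ?_ _
      exact cos_le_cos_of_nonneg_of_le_pi hη₀.le (by linarith [pi_gt_three]) (by linarith)
    have hsq : 1 / 16 ≤ (1 - T t) ^ 2 := by nlinarith
    calc _ ≤ 3 * (1 - T t) ^ 2 * T t * (1 - cos (θ t) ^ (2 * n)) / n := by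
          have := hTs t ht
          have hT₀' := (hT t).1
          gcongr
          linarith
      _ = _ := by simp only [X7]; ring
  have hgrow : T 0 + c * (1 / c) ≤ T (1 / c) := by
    refine image_le_of_deriv_right_le_deriv_boundary (a := 0) (b := 1 / c)
      (f := fun t ↦ T 0 + c * t) (f' := fun _ ↦ c) (by fun_prop)
      (fun x _ ↦ ?_) (by simp) (fun x _ ↦ (hT' x).continuousAt.continuousWithinAt)
      (fun x _ ↦ (hT' x).hasDerivWithinAt) (fun x hx ↦ hcT x hx.1) ⟨by positivity, le_rfl⟩
    simpa using (((hasDerivAt_id x).const_mul c).const_add (T 0)).hasDerivWithinAt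
  rw [mul_one_div_cancel hc.ne'] at hgrow
  linarith [(hT 0).1, (hT (1 / c)).2]
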